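/- arXiv:2004.09505 — 12 statements merged into one kernel-verified Lean document; each statement's English description precedes it below -/
import Mathlib

section
/- Let k be an integer, a an integer, and b a positive integer. Then there exists an integer c with c ⊙_k b = a (i.e., b divides a (arith k)) if and only if the rational number a/b + (b − 1)·(1 − k/2) is an integer. -/
/-- The `k`-arithmetic product: `m ⊙_k n = (m - n + 1)·n + (n·(n-1)/2)·k`.
    (`n * (n - 1)` is always even, so the integer division is exact.) -/
def kprod (k m n : ℤ) : ℤ := (m - n + 1) * n + n * (n - 1) / 2 * k

theorem cast_kprod (k m n : ℤ) :
    (kprod k m n : ℚ) = ((m : ℚ) - n + 1) * n + (n : ℚ) * (n - 1) / 2 * k := by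
  rw [kprod, Int.cast_add, Int.cast_mul (n * (n - 1) / 2),
    Int.cast_div (Int.even_mul_pred_self n).two_dvd (by norm_num)]
  push_cast
  ring

/-- For `b > 0`, there is an integer `c` with `c ⊙_k b = a` (i.e. `b` divides `a`
    (arith `k`)) iff the rational number `a/b + (b - 1)·(1 - k/2)` is an integer. -/
theorem stmt_1 (k a b : ℤ) (hb : 0 < b) :
    (∃ c : ℤ, kprod k c b = a) ↔
      ∃ m : ℤ, (a : ℚ) / (b : ℚ) + ((b : ℚ) - 1) * (1 - (k : ℚ) / 2) = (m : ℚ) := by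
  have hb' : (b : ℚ) ≠ 0 := by exact_mod_cast hb.ne'
  refine exists_congr fun c => ?_
  rw [← Int.cast_inj (α := ℚ), cast_kprod, ← eq_sub_iff_add_eq (a := (a : ℚ) / b), div_eq_iff hb']
  constructor <;> intro h <;> linear_combination -h
end

section
/- Let k be an even integer and a an integer. A positive integer d divides a (arith k) if and only if d divides a in the usual sense. -/
theorem kprod_two_mul (j m n : ℤ) :
    kprod (2 * j) m n = n * (m - n + 1 + (n - 1) * j) := by
  have h : n * (n - 1) / 2 * 2 = n * (n - 1) :=
    Int.ediv_mul_cancel (Int.even_mul_pred_self n).two_dvd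
  unfold kprod
  linear_combination j * h

/-- For even `k`, a positive integer `d` divides `a` (arith `k`) iff `d ∣ a`. -/
theorem stmt_2 (k a : ℤ) (hk : Even k) (d : ℤ) (hd : 0 < d) :
    (∃ b : ℤ, kprod k b d = a) ↔ d ∣ a := by
  obtain ⟨j, rfl⟩ := hk.exists_two_nsmul
  simp only [nsmul_eq_mul, Nat.cast_ofNat, kprod_two_mul]
  constructor
  · rintro ⟨b, rfl⟩
    exact dvd_mul_right _ _
  · rintro ⟨c, rfl⟩
    exact ⟨c + d - 1 - (d - 1) * j, by ring⟩
end

section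
/- Let n be a positive integer and k an odd integer. The number of positive integers d that divide n (arith k) — equivalently, the number of ways to express n as the sum of an arithmetic progression of integers with common difference k — equals twice the number of positive odd divisors of n. -/
/-- An odd `d` is an arithmetic divisor exactly when it is a divisor. -/
theorem exists_kprod_eq_iff_of_odd {d : ℕ} (hd : Odd d) (k : ℤ) (n : ℕ) :
    (∃ b : ℤ, kprod k b (d : ℤ) = (n : ℤ)) ↔ d ∣ n := by
  obtain ⟨c, rfl⟩ := hd
  have h (b : ℤ) : kprod k b ((2 * c + 1 : ℕ) : ℤ) = (2 * c + 1 : ℕ) * (b - 2 * c + c * k) := by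
    have h2 : ((2 * c + 1 : ℕ) : ℤ) * ((2 * c + 1 : ℕ) - 1) / 2 = (2 * c + 1) * c :=
      Int.ediv_eq_of_eq_mul_left two_ne_zero (by push_cast; ring)
    rw [kprod, h2]
    push_cast
    ring
  rw [← Int.natCast_dvd_natCast]
  constructor
  · rintro ⟨b, hb⟩
    exact ⟨_, hb.symm.trans (h b)⟩
  · rintro ⟨e, he⟩
    refine ⟨e + 2 * c - c * k, ?_⟩
    rw [h, he]
    ring

/-- For odd `k`, an even number `2 * c` is an arithmetic divisor of `n` exactly when `n` is an odd
multiple of `c`. -/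
theorem exists_kprod_two_mul_eq_iff {c : ℕ} (hc : 0 < c) {k : ℤ} (hk : Odd k) (n : ℕ) :
    (∃ b : ℤ, kprod k b ((2 * c : ℕ) : ℤ) = (n : ℤ)) ↔ ∃ e : ℕ, Odd e ∧ n = c * e := by
  obtain ⟨j, rfl⟩ := hk
  have h (b : ℤ) : kprod (2 * j + 1) b ((2 * c : ℕ) : ℤ)
      = c * (2 * (b - c + 2 * c * j - j) + 1) := by
    have h2 : ((2 * c : ℕ) : ℤ) * ((2 * c : ℕ) - 1) / 2 = c * (2 * c - 1) :=
      Int.ediv_eq_of_eq_mul_left two_ne_zero (by push_cast; ring)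
    rw [kprod, h2]
    push_cast
    ring
  constructor
  · rintro ⟨b, hb⟩
    rw [h] at hb
    have hpos : 0 ≤ 2 * (b - c + 2 * c * j - j) + 1 := by
      refine nonneg_of_mul_nonneg_right (a := (c : ℤ)) ?_ (by exact_mod_cast hc)
      rw [hb]
      positivity
    obtain ⟨e, he⟩ := Int.eq_ofNat_of_zero_le hpos
    refine ⟨e, ?_, ?_⟩
    · rw [← Int.odd_coe_nat]
      exact ⟨_, he.symm⟩
    · rw [he] at hb
      exact_mod_cast hb.symm
  · rintro ⟨e, ⟨i, rfl⟩, rfl⟩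
    refine ⟨i + c - 2 * c * j + j, ?_⟩
    rw [h]
    push_cast
    ring

/-- For `n > 0` and odd `k`, the number of positive integers `d` dividing `n`
    (arith `k`) equals twice the number of positive odd divisors of `n`. -/
theorem stmt_4 (n : ℕ) (hn : 0 < n) (k : ℤ) (hk : Odd k) :
    {d : ℕ | 0 < d ∧ ∃ b : ℤ, kprod k b (d : ℤ) = (n : ℤ)}.ncard
      = 2 * (n.divisors.filter (fun d => Odd d)).card := by
  set O := n.divisors.filter (fun d => Odd d) with hO
  have hmem {e : ℕ} : e ∈ O ↔ e ∣ n ∧ Odd e := by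
    simp [hO, hn.ne']
  have hset : {d : ℕ | 0 < d ∧ ∃ b : ℤ, kprod k b (d : ℤ) = (n : ℤ)}
      = ((O ∪ O.image (fun e => 2 * (n / e)) : Finset ℕ) : Set ℕ) := by
    ext d
    simp only [Set.mem_ofPred_eq, Finset.coe_union, Finset.coe_image, Set.mem_union,
      Finset.mem_coe, Set.mem_image, hmem]
    rcases Nat.even_or_odd' d with ⟨c, rfl | rfl⟩
    · constructor
      · rintro ⟨hd, hb⟩
        have hc : 0 < c := by omega
        obtain ⟨e, he, rfl⟩ := (exists_kprod_two_mul_eq_iff hc hk n).1 hb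
        exact Or.inr ⟨e, ⟨dvd_mul_left e c, he⟩, by rw [Nat.mul_div_cancel _ he.pos]⟩
      · rintro (⟨-, h⟩ | ⟨e, ⟨hen, he⟩, h⟩)
        · exact absurd h (by simp)
        · have hc : n / e = c := by omega
          have hnc : n = c * e := by rw [← hc, Nat.div_mul_cancel hen]
          have hcpos : 0 < c := Nat.pos_of_ne_zero (by rintro rfl; simp at hnc; omega)
          exact ⟨by omega, (exists_kprod_two_mul_eq_iff hcpos hk n).2 ⟨e, he, hnc⟩⟩
    · rw [exists_kprod_eq_iff_of_odd (odd_two_mul_add_one c)]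
      constructor
      · rintro ⟨-, h⟩
        exact Or.inl ⟨h, odd_two_mul_add_one c⟩
      · rintro (⟨h, -⟩ | ⟨e, -, h⟩)
        · exact ⟨by omega, h⟩
        · omega
  rw [hset, Set.ncard_coe_finset, Finset.card_union_of_disjoint, Finset.card_image_of_injOn, two_mul]
  · intro a ha b hb hab
    have ha' := (hmem.1 ha).1
    have hb' := (hmem.1 hb).1
    have h : n / a = n / b := Nat.eq_of_mul_eq_mul_left two_pos hab
    rw [← Nat.div_div_self ha' hn.ne', h, Nat.div_div_self hb' hn.ne']
  · rw [Finset.disjoint_left]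
    intro d hd hd'
    obtain ⟨e, -, rfl⟩ := Finset.mem_image.1 hd'
    exact absurd (hmem.1 hd).2 (by simp)
end

section
/- Let n be a positive integer and k an odd integer. Among the positive integers d dividing n (arith k), the number of even ones equals the number of odd ones, and each of these counts equals the number of positive odd divisors of n. -/
theorem exists_kprod_iff_of_odd {k : ℤ} {n d : ℕ} (hd : Odd d) :
    (∃ b : ℤ, kprod k b (d : ℤ) = (n : ℤ)) ↔ d ∣ n := by
  obtain ⟨e, rfl⟩ := hd
  have key : ((2 * e + 1 : ℕ) : ℤ) * (((2 * e + 1 : ℕ) : ℤ) - 1) / 2 = (2 * e + 1) * e := by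
    apply Int.ediv_eq_of_eq_mul_left (by norm_num)
    push_cast
    ring
  rw [← Int.natCast_dvd_natCast]
  simp only [kprod, key]
  push_cast
  constructor
  · rintro ⟨b, hb⟩
    exact ⟨b - 2 * e + e * k, by rw [← hb]; ring⟩
  · rintro ⟨c, hc⟩
    exact ⟨c + 2 * e - e * k, by rw [hc]; ring⟩

theorem exists_kprod_two_mul_iff {k : ℤ} (hk : Odd k) {n e : ℕ} (he : 0 < e) :
    (∃ b : ℤ, kprod k b ((2 * e : ℕ) : ℤ) = (n : ℤ)) ↔ ∃ j : ℕ, Odd j ∧ n = e * j := by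
  obtain ⟨l, rfl⟩ := hk
  have key : ((2 * e : ℕ) : ℤ) * (((2 * e : ℕ) : ℤ) - 1) / 2 = e * (2 * e - 1) := by
    apply Int.ediv_eq_of_eq_mul_left (by norm_num)
    push_cast
    ring
  simp only [kprod, key]
  push_cast
  constructor
  · rintro ⟨b, hb⟩
    have hn : (n : ℤ) = e * (2 * (b - 2 * e + 1 + (2 * e - 1) * l + e - 1) + 1) := by
      rw [← hb]
      ring
    obtain ⟨j, rfl⟩ : e ∣ n := Int.natCast_dvd_natCast.mp ⟨_, hn⟩
    refine ⟨j, ?_, rfl⟩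
    push_cast at hn
    have hj := mul_left_cancel₀ (by exact_mod_cast he.ne') hn
    rw [← Int.odd_coe_nat]
    exact ⟨_, hj⟩
  · rintro ⟨j, ⟨i, rfl⟩, rfl⟩
    refine ⟨i + 2 * e - (2 * e - 1) * l - e, ?_⟩
    push_cast
    ring

/-- For `n > 0` and odd `k`, among the positive integers `d` dividing `n`
    (arith `k`), the number of even ones equals the number of odd ones, and
    each count equals the number of positive odd divisors of `n`. -/
theorem stmt_5 (n : ℕ) (hn : 0 < n) (k : ℤ) (hk : Odd k) :
    {d : ℕ | 0 < d ∧ Even d ∧ ∃ b : ℤ, kprod k b (d : ℤ) = (n : ℤ)}.ncard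
        = (n.divisors.filter (fun d => Odd d)).card ∧
    {d : ℕ | 0 < d ∧ Odd d ∧ ∃ b : ℤ, kprod k b (d : ℤ) = (n : ℤ)}.ncard
        = (n.divisors.filter (fun d => Odd d)).card := by
  constructor
  · have hinj : Set.InjOn (fun j => 2 * (n / j)) (n.divisors.filter (fun d => Odd d)) := by
      intro i hi j hj hij
      simp only [Finset.coe_filter, Nat.mem_divisors, Set.mem_ofPred_eq] at hi hj hij
      rw [← Nat.div_div_self hi.1.1 hn.ne', ← Nat.div_div_self hj.1.1 hn.ne',
        Nat.eq_of_mul_eq_mul_left two_pos hij]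
    rw [← Finset.card_image_of_injOn hinj, ← Set.ncard_coe_finset]
    congr 1
    ext d
    simp only [Set.mem_ofPred_eq, Finset.coe_image, Finset.coe_filter, Nat.mem_divisors,
      Set.mem_image]
    constructor
    · rintro ⟨hd, hd2, h⟩
      obtain ⟨e, rfl⟩ := hd2.two_dvd
      obtain ⟨j, hj, rfl⟩ := (exists_kprod_two_mul_iff hk (e := e) (by omega)).mp h
      exact ⟨j, ⟨⟨dvd_mul_left j e, hn.ne'⟩, hj⟩, by rw [Nat.mul_div_cancel _ hj.pos]⟩
    · rintro ⟨j, ⟨⟨hjn, -⟩, hj⟩, rfl⟩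
      have he : 0 < n / j := Nat.div_pos (Nat.le_of_dvd hn hjn) hj.pos
      exact ⟨by omega, even_two_mul _,
        (exists_kprod_two_mul_iff hk he).mpr ⟨j, hj, (Nat.div_mul_cancel hjn).symm⟩⟩
  · rw [← Set.ncard_coe_finset]
    congr 1
    ext d
    simp only [Set.mem_ofPred_eq, Finset.coe_filter, Nat.mem_divisors]
    constructor
    · rintro ⟨-, hd, h⟩
      exact ⟨⟨(exists_kprod_iff_of_odd hd).mp h, hn.ne'⟩, hd⟩
    · rintro ⟨⟨h, -⟩, hd⟩
      exact ⟨hd.pos, hd, (exists_kprod_iff_of_odd hd).mpr h⟩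
end

section
/- Let n be a positive integer and k an even integer with k > 0. If d is a positive divisor of n with d > 1 and d² > n, then there is no integer c with c ⊙_k d = n and c − d + 1 > 0; that is, no partition of n into d positive parts in arithmetic progression with common difference k exists. -/
/-- For `n > 0`, even `k > 0`, and a divisor `d` of `n` with `1 < d` and
    `d² > n`, there is no partition of `n` into `d` positive parts in
    arithmetic progression with common difference `k`. -/
theorem stmt_7 (n : ℤ) (hn : 0 < n) (k : ℤ) (hk : Even k) (hk0 : 0 < k)
    (d : ℤ) (hdvd : d ∣ n) (hd1 : 1 < d) (hd2 : n < d ^ 2) :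
    ¬ ∃ c : ℤ, kprod k c d = n ∧ 0 < c - d + 1 := by
  rintro ⟨c, hc, hpos⟩
  have hT : d * (d - 1) / 2 * 2 = d * (d - 1) :=
    Int.ediv_mul_cancel (Int.even_mul_pred_self d).two_dvd
  have hk2 : 2 ≤ k := by
    obtain ⟨j, rfl⟩ := hk
    omega
  have hT0 : 0 ≤ d * (d - 1) / 2 :=
    Int.ediv_nonneg (mul_nonneg (by omega) (by omega)) (by norm_num)
  have hlin : d ≤ (c - d + 1) * d := le_mul_of_one_le_left (by omega) (by omega)
  have hquad : d * (d - 1) / 2 * 2 ≤ d * (d - 1) / 2 * k :=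
    mul_le_mul_of_nonneg_left hk2 hT0
  unfold kprod at hc
  linarith
end

section
/- Let n be a positive integer and k an odd integer with k > 0. If d > 1 is a positive integer dividing n (arith k) and d² ≥ 2n, then there is no integer c with c ⊙_k d = n and c − d + 1 > 0; that is, no partition of n into d positive parts in arithmetic progression with common difference k exists. -/
/-- For `n > 0`, odd `k > 0`, and `d > 1` dividing `n` (arith `k`) with
    `d² ≥ 2n`, there is no partition of `n` into `d` positive parts in
    arithmetic progression with common difference `k`. -/
theorem stmt_8 (n : ℤ) (hn : 0 < n) (k : ℤ) (hk : Odd k) (hk0 : 0 < k)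
    (d : ℤ) (hd1 : 1 < d) (hdvd : ∃ b : ℤ, kprod k b d = n) (hd2 : 2 * n ≤ d ^ 2) :
    ¬ ∃ c : ℤ, kprod k c d = n ∧ 0 < c - d + 1 := by
  rintro ⟨c, hc, hpos⟩
  unfold kprod at hc
  have heven : 2 * (d * (d - 1) / 2) = d * (d - 1) :=
    Int.mul_ediv_cancel' (Int.even_mul_pred_self d).two_dvd
  nlinarith [mul_le_mul_of_nonneg_right (show 1 ≤ c - d + 1 by lia) (show 0 ≤ d by lia),
    mul_le_mul_of_nonneg_left (show 1 ≤ k by lia) (show 0 ≤ d * (d - 1) / 2 by nlinarith)]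
end

section
/- Let n be a positive integer and k an odd integer. If a positive integer d divides n (arith k), then d² ≠ 2n. (Indeed, if d² = 2n then d would be an even divisor of n, which is excluded.) -/
/-- For `n > 0` and odd `k`, if a positive integer `d` divides `n` (arith `k`),
    then `d² ≠ 2n`. -/
theorem stmt_9 (n : ℤ) (hn : 0 < n) (k : ℤ) (hk : Odd k)
    (d : ℤ) (hd : 0 < d) (hdvd : ∃ b : ℤ, kprod k b d = n) :
    d ^ 2 ≠ 2 * n := by
  obtain ⟨b, hb⟩ := hdvd
  intro h
  have hhalf : 2 * (d * (d - 1) / 2) = d * (d - 1) :=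
    Int.mul_ediv_cancel' (Int.even_mul_pred_self d).two_dvd
  have hd_eq : d = 2 * (b - d + 1) + (d - 1) * k := by
    apply mul_left_cancel₀ hd.ne'
    unfold kprod at hb
    linear_combination h - 2 * hb + k * hhalf
  have hd_even : Even d := (Int.even_pow' two_ne_zero).1 (h ▸ even_two_mul n)
  have hodd : Odd (2 * (b - d + 1) + (d - 1) * k) :=
    (even_two_mul _).add_odd ((hd_even.sub_odd odd_one).mul hk)
  exact Int.not_even_iff_odd.2 (hd_eq ▸ hodd) hd_even
end

section
/- Let n be a positive integer. Then the cardinality of AP(n) equals τ(n) + Σ_{d ∈ D_E(n), 1 < d, d² ≤ n} ⌊(⌈2n/(d(d−1))⌉ − 1)/2⌋ + Σ_{d ∈ D_O(n), 1 < d, d² < 2n} ⌊⌈2n/(d(d−1))⌉/2⌋, where the ceilings are taken of the rational numbers 2n/(d(d−1)). -/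
/-- `AP n` is the set of partitions of `n` whose nondecreasing parts form an
    arithmetic progression, encoded as triples `(a, k, d)`: first term `a > 0`,
    common difference `k ≥ 0`, number of parts `d > 0`, with
    `d·a + (d·(d-1)/2)·k = n`, normalized so that `k = 0` whenever `d = 1`. -/
def AP (n : ℕ) : Set (ℕ × ℕ × ℕ) :=
  {t | 0 < t.1 ∧ 0 < t.2.2 ∧ t.2.2 * t.1 + t.2.2 * (t.2.2 - 1) / 2 * t.2.1 = n ∧
       (t.2.2 = 1 → t.2.1 = 0)}

/-- Solvability in the first term `a` when the common difference `2 * j` is even. -/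
lemma exists_firstTerm_even_iff {n d : ℕ} (hd : 0 < d) (j : ℕ) :
    (∃ a, 0 < a ∧ d * a + d * (d - 1) / 2 * (2 * j) = n) ↔ d ∣ n ∧ d * (d - 1) * j < n := by
  have h2 : d * (d - 1) / 2 * (2 * j) = d * (d - 1) * j := by
    rw [← mul_assoc, Nat.div_mul_cancel (Nat.even_mul_pred_self d).two_dvd]
  rw [h2]
  constructor
  · rintro ⟨a, ha, rfl⟩
    refine ⟨⟨a + (d - 1) * j, by ring⟩, ?_⟩
    have := Nat.mul_pos hd ha
    omega
  · rintro ⟨⟨m, rfl⟩, h⟩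
    rw [mul_assoc] at h ⊢
    have h' := Nat.lt_of_mul_lt_mul_left h
    refine ⟨m - (d - 1) * j, by omega, ?_⟩
    rw [← mul_add, Nat.sub_add_cancel h'.le]

/-- Solvability in the first term `a` when the common difference `2 * j + 1` is odd. -/
lemma exists_firstTerm_odd_iff {n d : ℕ} (hd : 0 < d) (j : ℕ) :
    (∃ a, 0 < a ∧ d * a + d * (d - 1) / 2 * (2 * j + 1) = n) ↔
      d ∣ 2 * n ∧ ¬(Even d ∧ d ∣ n) ∧ d * (d - 1) * (2 * j + 1) < 2 * n := by
  have h2 : 2 * (d * (d - 1) / 2) = d * (d - 1) :=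
    Nat.mul_div_cancel' (Nat.even_mul_pred_self d).two_dvd
  have key (a : ℕ) : d * a + d * (d - 1) / 2 * (2 * j + 1) = n ↔
      d * (2 * a + (d - 1) * (2 * j + 1)) = 2 * n := by
    have : d * (2 * a + (d - 1) * (2 * j + 1)) =
        2 * (d * a + d * (d - 1) / 2 * (2 * j + 1)) := by
      linear_combination (2 * j + 1) * h2.symm
    omega
  simp only [key]
  constructor
  · rintro ⟨a, ha, h⟩
    refine ⟨⟨_, h.symm⟩, ?_, ?_⟩
    · rintro ⟨he, m, rfl⟩
      have h' : 2 * a + (d - 1) * (2 * j + 1) = 2 * m :=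
        Nat.eq_of_mul_eq_mul_left hd (by linarith)
      have ho : Odd ((d - 1) * (2 * j + 1)) :=
        (Nat.Even.sub_odd hd he odd_one).mul (odd_two_mul_add_one j)
      obtain ⟨r, hr⟩ := ho
      omega
    · rw [← h, mul_assoc]
      exact Nat.mul_lt_mul_of_pos_left (by omega) hd
  · rintro ⟨⟨m, hm⟩, hne, h⟩
    rw [hm, mul_assoc] at h
    have h' := Nat.lt_of_mul_lt_mul_left h
    have hpar : Even (m - (d - 1) * (2 * j + 1)) := by
      rw [Nat.even_sub h'.le]
      rcases Nat.even_or_odd d with he | ho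
      · have hmo : ¬ Even m := by
          rintro ⟨r, rfl⟩
          exact hne ⟨he, r, by linarith⟩
        have : Odd ((d - 1) * (2 * j + 1)) :=
          (Nat.Even.sub_odd hd he odd_one).mul (odd_two_mul_add_one j)
        simp [hmo, this]
      · have hme : Even m := by
          have : Even (d * m) := ⟨n, by omega⟩
          exact (Nat.even_mul.1 this).resolve_left (Nat.not_even_iff_odd.2 ho)
        have : Even ((d - 1) * (2 * j + 1)) := (Nat.Odd.sub_odd ho odd_one).mul_right _
        simp [hme, this]
    obtain ⟨a, ha⟩ := hpar
    refine ⟨a, by omega, ?_⟩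
    rw [hm]
    congr 1
    omega

lemma floor_intCast_div_two (c : ℤ) : ⌊(c : ℚ) / 2⌋ = c / 2 := by
  exact_mod_cast Rat.floor_intCast_div_natCast c 2

lemma lt_ceil_div_mul_pred_iff {d : ℕ} (hd : 1 < d) (n : ℕ) (k : ℕ) :
    (k : ℤ) < ⌈(2 * n : ℚ) / ((d : ℚ) * ((d : ℚ) - 1))⌉ ↔ d * (d - 1) * k < 2 * n := by
  have hd' : (1 : ℚ) < d := by exact_mod_cast hd
  have hpos : (0 : ℚ) < (d : ℚ) * ((d : ℚ) - 1) := mul_pos (by linarith) (by linarith)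
  rw [Int.lt_ceil, lt_div_iff₀ hpos, ← Nat.cast_lt (α := ℚ)]
  push_cast [Nat.cast_sub hd.le]
  rw [mul_comm]

lemma sq_le_of_dvd_of_mul_pred_lt {n d j : ℕ} (hdvd : d ∣ n)
    (h : d * (d - 1) * (j + 1) < n) : d ^ 2 ≤ n := by
  obtain ⟨m, rfl⟩ := hdvd
  rw [mul_assoc] at h
  have h' := Nat.lt_of_mul_lt_mul_left h
  rw [sq]
  refine Nat.mul_le_mul_left d ?_
  have : (d - 1) * (j + 1) = (d - 1) * j + (d - 1) := by ring
  omega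

lemma sq_ne_two_mul_of_not_even_dvd {n d : ℕ} (h : ¬(Even d ∧ d ∣ n)) : d ^ 2 ≠ 2 * n := by
  intro hsq
  have he : Even d := by
    have : Even (d ^ 2) := ⟨n, by omega⟩
    exact (Nat.even_pow.1 this).1
  refine h ⟨he, ?_⟩
  obtain ⟨r, rfl⟩ := he
  exact ⟨r, by nlinarith⟩

/-- A progression is determined by its common difference and its number of parts. -/
lemma injOn_snd_AP (n : ℕ) : Set.InjOn Prod.snd (AP n) := by
  rintro ⟨a, k, d⟩ ⟨-, hd, h, -⟩ ⟨a', k', d'⟩ ⟨-, -, h', -⟩ he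
  obtain ⟨rfl, rfl⟩ := Prod.mk.inj he
  dsimp only at hd h h'
  have : d * a = d * a' := by omega
  rw [Nat.eq_of_mul_eq_mul_left hd this]

lemma mem_image_snd_AP_iff {n k d : ℕ} :
    (k, d) ∈ Prod.snd '' AP n ↔
      0 < d ∧ (d = 1 → k = 0) ∧ ∃ a, 0 < a ∧ d * a + d * (d - 1) / 2 * k = n := by
  simp only [AP, Set.mem_image, Set.mem_ofPred_eq, Prod.exists, Prod.mk.injEq]
  constructor
  · rintro ⟨a, k, d, ⟨ha, hd, h, h1⟩, rfl, rfl⟩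
    exact ⟨hd, h1, a, ha, h⟩
  · rintro ⟨hd, h1, a, ha, h⟩
    exact ⟨a, k, d, ⟨ha, hd, h, h1⟩, rfl, rfl⟩

/-- The number of partitions of `n > 0` into positive parts in nondecreasing
    arithmetic progression equals
    `τ(n) + Σ_{d ∣ n, 1 < d, d² ≤ n} ⌊(⌈2n/(d(d-1))⌉ - 1)/2⌋
          + Σ_{d ∣ 2n, ¬(d even ∧ d ∣ n), 1 < d, d² < 2n} ⌊⌈2n/(d(d-1))⌉/2⌋`. -/
theorem stmt_12 (n : ℕ) (hn : 0 < n) :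
    ((AP n).ncard : ℤ)
      = (n.divisors.card : ℤ)
        + ∑ d ∈ n.divisors.filter (fun d => 1 < d ∧ d ^ 2 ≤ n),
            ⌊(((⌈(2 * n : ℚ) / ((d : ℚ) * ((d : ℚ) - 1))⌉ : ℤ) : ℚ) - 1) / 2⌋
        + ∑ d ∈ ((2 * n).divisors.filter (fun d => ¬(Even d ∧ d ∣ n))).filter
              (fun d => 1 < d ∧ d ^ 2 < 2 * n),
            ⌊((⌈(2 * n : ℚ) / ((d : ℚ) * ((d : ℚ) - 1))⌉ : ℤ) : ℚ) / 2⌋ := by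
  set c : ℕ → ℤ := fun d => ⌈(2 * n : ℚ) / ((d : ℚ) * ((d : ℚ) - 1))⌉
  set E := n.divisors.filter (fun d => 1 < d ∧ d ^ 2 ≤ n) with hE
  set O := ((2 * n).divisors.filter (fun d => ¬(Even d ∧ d ∣ n))).filter
    (fun d => 1 < d ∧ d ^ 2 < 2 * n) with hO
  have hlt {d : ℕ} (hd : 1 < d) (k : ℕ) : (k : ℤ) < c d ↔ d * (d - 1) * k < 2 * n :=
    lt_ceil_div_mul_pred_iff hd n k
  have hcpos {d : ℕ} (hd : 1 < d) : 0 < c d := by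
    exact_mod_cast (hlt hd 0).2 (by omega)
  let Z : Finset (ℕ × ℕ) := n.divisors.image fun d => (0, d)
  let S : Finset (ℕ × ℕ) := (E.sigma fun d => Finset.range ((c d - 1) / 2).toNat).image
    fun x => (2 * (x.2 + 1), x.1)
  let T : Finset (ℕ × ℕ) := (O.sigma fun d => Finset.range (c d / 2).toNat).image
    fun x => (2 * x.2 + 1, x.1)
  have hZ : Z.card = n.divisors.card :=
    Finset.card_image_of_injective _ fun _ _ h => (Prod.mk.inj h).2
  have hS : S.card = ∑ d ∈ E, ((c d - 1) / 2).toNat := by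
    rw [Finset.card_image_of_injective, Finset.card_sigma]
    · simp
    · rintro ⟨d, j⟩ ⟨d', j'⟩ h
      simp only [Prod.mk.injEq] at h
      obtain ⟨h, rfl⟩ := h
      obtain rfl : j = j' := by omega
      rfl
  have hT : T.card = ∑ d ∈ O, (c d / 2).toNat := by
    rw [Finset.card_image_of_injective, Finset.card_sigma]
    · simp
    · rintro ⟨d, j⟩ ⟨d', j'⟩ h
      simp only [Prod.mk.injEq] at h
      obtain ⟨h, rfl⟩ := h
      obtain rfl : j = j' := by omega
      rfl
  have memZ (k d : ℕ) : (k, d) ∈ Z ↔ k = 0 ∧ d ∣ n := by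
    simp only [Z, Finset.mem_image, Nat.mem_divisors, Prod.mk.injEq]
    constructor
    · rintro ⟨d, h, rfl, rfl⟩
      exact ⟨rfl, h.1⟩
    · rintro ⟨rfl, h⟩
      exact ⟨d, ⟨h, hn.ne'⟩, rfl, rfl⟩
  have memS (k d : ℕ) : (k, d) ∈ S ↔
      ∃ j, k = 2 * (j + 1) ∧ 1 < d ∧ d ∣ n ∧ d * (d - 1) * (j + 1) < n := by
    have hj (hd : 1 < d) (j : ℕ) :
        j < ((c d - 1) / 2).toNat ↔ d * (d - 1) * (j + 1) < n := by
      have h1 := hlt hd (2 * (j + 1))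
      have h2 : d * (d - 1) * (2 * (j + 1)) = 2 * (d * (d - 1) * (j + 1)) := by ring
      omega
    simp only [S, hE, Finset.mem_image, Finset.mem_sigma, Finset.mem_filter,
      Nat.mem_divisors, Finset.mem_range, Prod.mk.injEq]
    constructor
    · rintro ⟨⟨d, j⟩, ⟨⟨⟨hdvd, -⟩, hd, -⟩, h⟩, rfl, rfl⟩
      exact ⟨j, rfl, hd, hdvd, (hj hd j).1 h⟩
    · rintro ⟨j, rfl, hd, hdvd, h⟩
      exact ⟨⟨d, j⟩, ⟨⟨⟨hdvd, hn.ne'⟩, hd, sq_le_of_dvd_of_mul_pred_lt hdvd h⟩,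
        (hj hd j).2 h⟩, rfl, rfl⟩
  have memT (k d : ℕ) : (k, d) ∈ T ↔ ∃ j, k = 2 * j + 1 ∧ 1 < d ∧ d ∣ 2 * n ∧
      ¬(Even d ∧ d ∣ n) ∧ d * (d - 1) * (2 * j + 1) < 2 * n := by
    have hj (hd : 1 < d) (j : ℕ) :
        j < (c d / 2).toNat ↔ d * (d - 1) * (2 * j + 1) < 2 * n := by
      have h1 := hlt hd (2 * j + 1)
      omega
    simp only [T, hO, Finset.mem_image, Finset.mem_sigma, Finset.mem_filter,
      Nat.mem_divisors, Finset.mem_range, Prod.mk.injEq]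
    constructor
    · rintro ⟨⟨d, j⟩, ⟨⟨⟨⟨hdvd, -⟩, hne⟩, hd, -⟩, h⟩, rfl, rfl⟩
      exact ⟨j, rfl, hd, hdvd, hne, (hj hd j).1 h⟩
    · rintro ⟨j, rfl, hd, hdvd, hne, h⟩
      exact ⟨⟨d, j⟩, ⟨⟨⟨⟨hdvd, by omega⟩, hne⟩, hd,
        (sq_le_of_dvd_of_mul_pred_lt hdvd h).lt_of_ne (sq_ne_two_mul_of_not_even_dvd hne)⟩,
        (hj hd j).2 h⟩, rfl, rfl⟩
  have himage : Prod.snd '' AP n = ↑(Z ∪ S ∪ T) := by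
    ext ⟨k, d⟩
    rw [mem_image_snd_AP_iff]
    simp only [Finset.coe_union, Set.mem_union, Finset.mem_coe, memZ, memS, memT]
    constructor
    · rintro ⟨hd, h1, h⟩
      obtain ⟨j, rfl | rfl⟩ := Nat.even_or_odd' k
      · rw [exists_firstTerm_even_iff hd] at h
        rcases j with _ | j
        · exact .inl (.inl ⟨rfl, h.1⟩)
        · exact .inl (.inr ⟨j, rfl, by omega, h⟩)
      · exact .inr ⟨j, rfl, by omega, (exists_firstTerm_odd_iff hd j).1 h⟩
    · rintro ((⟨rfl, h⟩ | ⟨j, rfl, hd, h⟩) | ⟨j, rfl, hd, h⟩)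
      · have hd := Nat.pos_of_dvd_of_pos h hn
        exact ⟨hd, fun _ => rfl, (exists_firstTerm_even_iff hd 0).2 ⟨h, by simpa⟩⟩
      · exact ⟨by omega, by omega, (exists_firstTerm_even_iff (by omega) (j + 1)).2 h⟩
      · exact ⟨by omega, by omega, (exists_firstTerm_odd_iff (by omega) j).2 h⟩
  have hZS : Disjoint Z S := Finset.disjoint_left.2 fun ⟨k, d⟩ h h' => by
    obtain ⟨h, -⟩ := (memZ k d).1 h
    obtain ⟨j, h', -⟩ := (memS k d).1 h'
    omega
  have hZST : Disjoint (Z ∪ S) T := Finset.disjoint_left.2 fun ⟨k, d⟩ h h' => by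
    obtain ⟨i, h', -⟩ := (memT k d).1 h'
    rcases Finset.mem_union.1 h with h | h
    · obtain ⟨h, -⟩ := (memZ k d).1 h
      omega
    · obtain ⟨j, h, -⟩ := (memS k d).1 h
      omega
  rw [← (injOn_snd_AP n).ncard_image, himage, Set.ncard_coe_finset,
    Finset.card_union_of_disjoint hZST, Finset.card_union_of_disjoint hZS, hZ, hS, hT]
  push_cast
  congr 1
  · congr 1
    refine Finset.sum_congr rfl fun d hd => ?_
    have := hcpos (Finset.mem_filter.1 hd).2.1
    have h := floor_intCast_div_two (c d - 1)
    push_cast at h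
    rw [h]
    omega
  · refine Finset.sum_congr rfl fun d hd => ?_
    have := hcpos (Finset.mem_filter.1 hd).2.1
    have h := floor_intCast_div_two (c d)
    rw [h]
    omega
end

section
/- Let n be a positive integer. Then APdiv(n) = D_E(n) ∪ { d : d even, d ∈ D_O(n), 1 < d, d² < 2n }; that is, the set of lengths of partitions of n into positive parts in nondecreasing arithmetic progression consists of the positive divisors of n together with the even divisors d of 2n that do not divide n and satisfy 1 < d and d² < 2n. -/
/-- `APdiv n` is the set of lengths `d` of partitions of `n` into positive
    parts in nondecreasing arithmetic progression: positive `d` such that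
    `d·a + (d·(d-1)/2)·k = n` for some first term `a > 0` and common
    difference `k ≥ 0`. -/
def APdiv (n : ℕ) : Set ℕ :=
  {d | 0 < d ∧ ∃ a k : ℕ, 0 < a ∧ d * a + d * (d - 1) / 2 * k = n}

theorem two_mul_self_mul_pred_div_two (m : ℕ) : 2 * m * (2 * m - 1) / 2 = m * (2 * m - 1) := by
  rw [mul_assoc, Nat.mul_div_cancel_left _ two_pos]

theorem dvd_mul_pred_div_two_of_odd {d : ℕ} (hd : Odd d) : d ∣ d * (d - 1) / 2 := by
  obtain ⟨m, rfl⟩ := hd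
  refine ⟨m, ?_⟩
  rw [Nat.add_sub_cancel, mul_left_comm, Nat.mul_div_cancel_left _ two_pos]

/-- For `n > 0`, the set of lengths of partitions of `n` into positive parts in
    nondecreasing arithmetic progression consists of the positive divisors of
    `n` together with the even divisors `d` of `2n` that do not divide `n` and
    satisfy `1 < d` and `d² < 2n`. -/
theorem stmt_13 (n : ℕ) (hn : 0 < n) :
    APdiv n = {d : ℕ | 0 < d ∧ d ∣ n} ∪
      {d : ℕ | Even d ∧ d ∣ 2 * n ∧ ¬ d ∣ n ∧ 1 < d ∧ d ^ 2 < 2 * n} := by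
  ext d
  simp only [APdiv, Set.mem_union, Set.mem_ofPred_eq]
  constructor
  · rintro ⟨hd, a, k, ha, rfl⟩
    rcases Nat.even_or_odd' d with ⟨m, rfl | rfl⟩
    · by_cases hdvd : 2 * m ∣ 2 * m * a + 2 * m * (2 * m - 1) / 2 * k
      · exact Or.inl ⟨hd, hdvd⟩
      · refine Or.inr ⟨even_two_mul m, ?_, hdvd, by omega, ?_⟩
        · rw [two_mul_self_mul_pred_div_two]
          exact ⟨2 * a + (2 * m - 1) * k, by ring⟩
        · have hk : 0 < k := Nat.pos_of_ne_zero (by rintro rfl; simp at hdvd)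
          obtain ⟨j, rfl⟩ : ∃ j, m = j + 1 := ⟨m - 1, by omega⟩
          rw [two_mul_self_mul_pred_div_two, show 2 * (j + 1) - 1 = 2 * j + 1 by omega]
          have h₁ : 2 * (j + 1) * 1 ≤ 2 * (j + 1) * a := Nat.mul_le_mul_left _ ha
          have h₂ : (j + 1) * (2 * j + 1) * 1 ≤ (j + 1) * (2 * j + 1) * k :=
            Nat.mul_le_mul_left _ hk
          nlinarith
    · exact Or.inl ⟨hd, dvd_add (dvd_mul_right _ _)
        ((dvd_mul_pred_div_two_of_odd (odd_two_mul_add_one m)).mul_right k)⟩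
  · rintro (⟨hd, c, rfl⟩ | ⟨heven, ⟨c, hc⟩, hndvd, hd, hlt⟩)
    · exact ⟨hd, c, 0, Nat.pos_of_mul_pos_left hn, by simp⟩
    · obtain ⟨m, rfl⟩ := heven.exists_two_nsmul
      simp only [smul_eq_mul] at *
      obtain rfl : n = m * c := by linarith
      have hmc : 2 * m < c := by nlinarith
      rcases Nat.even_or_odd' c with ⟨b, rfl | rfl⟩
      · exact absurd ⟨b, by ring⟩ hndvd
      · refine ⟨by omega, b + 1 - m, 1, by omega, ?_⟩
        rw [two_mul_self_mul_pred_div_two, mul_one, mul_comm 2 m, mul_assoc, ← mul_add]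
        congr 1
        omega
end

section
/- Let n be a positive integer. Then |APdiv(n)| = τ(n) + #{ d : d even, d ∈ D_O(n), 1 < d, d² < 2n }; that is, the number of distinct lengths of partitions of n into positive parts in nondecreasing arithmetic progression equals the number of positive divisors of n plus the number of even divisors d of 2n that do not divide n and satisfy 1 < d and d² < 2n. -/
/-- An odd length of an arithmetic progression divides its sum. -/
theorem dvd_of_mem_APdiv_of_not_even {n d : ℕ} (hd : ¬ Even d) (h : d ∈ APdiv n) : d ∣ n := by
  obtain ⟨-, a, k, -, rfl⟩ := h
  obtain ⟨m, rfl⟩ := Nat.not_even_iff_odd.mp hd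
  have hm : (2 * m + 1) * (2 * m + 1 - 1) / 2 = (2 * m + 1) * m := by
    rw [Nat.add_sub_cancel, show (2 * m + 1) * (2 * m) = (2 * m + 1) * m * 2 by ring,
      Nat.mul_div_cancel _ two_pos]
  rw [hm, mul_assoc]
  exact dvd_add (dvd_mul_right _ _) (dvd_mul_right _ _)

/-- The sum of an arithmetic progression of even length `2 * (m + 1)`. -/
theorem two_mul_succ_mem_APdiv_iff {n m : ℕ} :
    2 * (m + 1) ∈ APdiv n ↔ ∃ a k : ℕ, 0 < a ∧ (m + 1) * (2 * a + (2 * m + 1) * k) = n := by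
  have hm : 2 * (m + 1) * (2 * (m + 1) - 1) / 2 = (m + 1) * (2 * m + 1) := by
    rw [show 2 * (m + 1) - 1 = 2 * m + 1 by omega, mul_assoc, Nat.mul_div_cancel_left _ two_pos]
  have heq (a k : ℕ) : 2 * (m + 1) * a + (m + 1) * (2 * m + 1) * k
      = (m + 1) * (2 * a + (2 * m + 1) * k) := by ring
  simp only [APdiv, Set.mem_ofPred_eq, hm, heq]
  exact and_iff_right (by omega)

theorem mem_APdiv_of_dvd {n d : ℕ} (hn : 0 < n) (h : d ∣ n) : d ∈ APdiv n := by
  obtain ⟨c, rfl⟩ := h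
  exact ⟨Nat.pos_of_mul_pos_right hn, c, 0, Nat.pos_of_mul_pos_left hn, by simp⟩

theorem mem_APdiv_iff_of_not_dvd {n d : ℕ} (hn : 0 < n) (h : ¬ d ∣ n) :
    d ∈ APdiv n ↔ d ∣ 2 * n ∧ Even d ∧ 1 < d ∧ d ^ 2 < 2 * n := by
  by_cases hd : Even d
  swap
  · exact ⟨fun hA => absurd (dvd_of_mem_APdiv_of_not_even hd hA) h, fun hA => absurd hA.2.1 hd⟩
  obtain ⟨m, rfl⟩ := even_iff_exists_two_mul.mp hd
  rcases m with _ | m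
  · exact ⟨fun hA => absurd hA.1 (by simp), fun hA => absurd hA.2.2.1 (by simp)⟩
  rw [two_mul_succ_mem_APdiv_iff]
  constructor
  · rintro ⟨a, k, ha, rfl⟩
    have hk : 0 < k := by
      rw [Nat.pos_iff_ne_zero]
      rintro rfl
      exact h ⟨a, by ring⟩
    refine ⟨⟨2 * a + (2 * m + 1) * k, by ring⟩, hd, by omega, ?_⟩
    have hq : 2 * m + 2 < 2 * a + (2 * m + 1) * k := by nlinarith
    nlinarith
  · rintro ⟨hdvd, -, -, hlt⟩
    obtain ⟨q, rfl⟩ := Nat.dvd_of_mul_dvd_mul_left two_pos hdvd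
    have hq : 2 * m + 2 < q := by
      by_contra! hle
      nlinarith [Nat.mul_le_mul_left (m + 1) hle]
    have hodd : Odd q := by
      rw [← Nat.not_even_iff_odd, even_iff_exists_two_mul]
      rintro ⟨c, rfl⟩
      exact h ⟨c, by ring⟩
    obtain ⟨c, rfl⟩ := hodd
    exact ⟨c - m, 1, by omega, by congr 1; omega⟩

/-- For `n > 0`, the number of distinct lengths of partitions of `n` into
    positive parts in nondecreasing arithmetic progression equals `τ(n)` plus
    the number of even divisors `d` of `2n` not dividing `n` with `1 < d` and
    `d² < 2n`. -/
theorem stmt_14 (n : ℕ) (hn : 0 < n) :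
    (APdiv n).ncard
      = n.divisors.card
        + ((2 * n).divisors.filter
            (fun d => Even d ∧ ¬ d ∣ n ∧ 1 < d ∧ d ^ 2 < 2 * n)).card := by
  rw [← Finset.card_union_of_disjoint, ← Set.ncard_coe_finset]
  · congr 1
    ext d
    by_cases h : d ∣ n
    · simp [h, hn.ne', mem_APdiv_of_dvd hn h]
    · simp [h, hn.ne', mem_APdiv_iff_of_not_dvd hn h]
  · rw [Finset.disjoint_left]
    intro d hd hd'
    exact (Finset.mem_filter.mp hd').2.2.1 (Nat.dvd_of_mem_divisors hd)
end

section
/- Let n be a positive integer and d a positive divisor of n with d > 1 and d² ≤ n. Then the number of even integers k with 0 < k for which n admits a partition into d positive parts in nondecreasing arithmetic progression with common difference k equals ⌊(⌈2n/(d(d−1))⌉ − 1)/2⌋, the ceiling being taken of the rational number 2n/(d(d−1)). -/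
/-- An integer `j` is at most `⌊(⌈x⌉ - 1) / 2⌋` exactly when `2 * j < x`. -/
theorem le_floor_ceil_sub_one_div_two_iff (x : ℚ) (j : ℤ) :
    j ≤ ⌊((⌈x⌉ : ℚ) - 1) / 2⌋ ↔ 2 * (j : ℚ) < x := by
  have hceil := Int.lt_ceil (a := x) (z := 2 * j)
  push_cast at hceil
  rw [← hceil, Int.le_floor, le_div_iff₀ two_pos, le_sub_iff_add_le]
  norm_cast
  rw [mul_comm, Int.add_one_le_iff]

/-- The positive even integers up to `2 * N` number `N`. -/
theorem ncard_pos_even_le (N : ℤ) (hN : 0 ≤ N) :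
    ((((2 : ℤ) * ·) '' Set.Icc 1 N).ncard : ℤ) = N := by
  rw [Set.ncard_image_of_injective _ (mul_right_injective₀ two_ne_zero),
    ← Finset.coe_Icc, Set.ncard_coe_finset, Int.card_Icc]
  omega

/-- Let `n > 0` and let `d ∣ n` with `1 < d` and `d² ≤ n`. The number of even
    integers `k > 0` for which `n` admits a partition into `d` positive parts
    in nondecreasing arithmetic progression with common difference `k` (i.e.
    there is a positive integer `a` with `d·a + (d·(d-1)/2)·k = n`) equals
    `⌊(⌈2n/(d(d-1))⌉ - 1)/2⌋`. -/
theorem stmt_16 (n : ℕ) (hn : 0 < n) (d : ℕ) (hdvd : d ∣ n) (hd1 : 1 < d)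
    (hd2 : d ^ 2 ≤ n) :
    ({k : ℤ | 0 < k ∧ Even k ∧
        ∃ a : ℤ, 0 < a ∧ (d : ℤ) * a + (d : ℤ) * ((d : ℤ) - 1) / 2 * k = (n : ℤ)}.ncard : ℤ)
      = ⌊(((⌈(2 * n : ℚ) / ((d : ℚ) * ((d : ℚ) - 1))⌉ : ℤ) : ℚ) - 1) / 2⌋ := by
  obtain ⟨m, rfl⟩ := hdvd
  have hm : 0 < m := Nat.pos_of_mul_pos_left hn
  have hdQ : (0 : ℚ) < (d : ℚ) - 1 := sub_pos.2 (by exact_mod_cast hd1)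
  have hdpos : (0 : ℚ) < d := by linarith
  have hle (j : ℤ) :
      j ≤ ⌊(((⌈(2 * (d * m : ℕ) : ℚ) / ((d : ℚ) * ((d : ℚ) - 1))⌉ : ℤ) : ℚ) - 1) / 2⌋ ↔
        ((d : ℤ) - 1) * j < m := by
    rw [le_floor_ceil_sub_one_div_two_iff, lt_div_iff₀ (mul_pos hdpos hdQ)]
    have hscale : 2 * (j : ℚ) * (d * ((d : ℚ) - 1)) < 2 * (d * m : ℕ) ↔
        ((d : ℚ) - 1) * j < m := by
      rw [← mul_lt_mul_iff_right₀ (b := ((d : ℚ) - 1) * j) (mul_pos two_pos hdpos)]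
      push_cast
      ring_nf
    rw [hscale]
    exact_mod_cast Iff.rfl
  rw [← ncard_pos_even_le _ ((hle 0).2 (by simpa using hm))]
  congr 2
  ext k
  have hdZ : (d : ℤ) ≠ 0 := by omega
  have hsum (a j : ℤ) : (d : ℤ) * a + (d : ℤ) * ((d : ℤ) - 1) / 2 * (2 * j) = (d * m : ℕ) ↔
      a + ((d : ℤ) - 1) * j = m := by
    have htwo : (d : ℤ) * ((d : ℤ) - 1) / 2 * 2 = d * ((d : ℤ) - 1) :=
      Int.ediv_mul_cancel (Int.even_mul_pred_self d).two_dvd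
    rw [← mul_assoc, htwo, mul_assoc, ← mul_add, Nat.cast_mul, mul_right_inj' hdZ]
  simp only [Set.mem_ofPred_eq, Set.mem_image, Set.mem_Icc, hle]
  constructor
  · rintro ⟨hk, hev, a, ha, h⟩
    obtain ⟨j, rfl⟩ := hev.two_dvd
    rw [hsum] at h
    exact ⟨j, ⟨by omega, by linarith⟩, rfl⟩
  · rintro ⟨j, ⟨hj, hjm⟩, rfl⟩
    exact ⟨by omega, even_two_mul j, m - ((d : ℤ) - 1) * j, by linarith,
      (hsum _ _).2 (by ring)⟩
end

section
/- Let n be a positive integer and d a positive divisor of 2n that is not an even divisor of n, with d > 1 and d² < 2n. Then the number of odd integers k with 0 < k for which n admits a partition into d positive parts in nondecreasing arithmetic progression with common difference k equals ⌊⌈2n/(d(d−1))⌉/2⌋, the ceiling being taken of the rational number 2n/(d(d−1)). -/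
/-- The odd positive integers below `c` are `2 * i + 1` for `0 ≤ i < c / 2`. -/
theorem ncard_odd_pos_lt (c : ℤ) (hc : 0 ≤ c) :
    ({k : ℤ | 0 < k ∧ Odd k ∧ k < c}.ncard : ℤ) = c / 2 := by
  have h : {k : ℤ | 0 < k ∧ Odd k ∧ k < c} =
      (fun i : ℤ => 2 * i + 1) '' (Finset.Ico 0 (c / 2) : Finset ℤ) := by
    ext k
    simp only [Set.mem_ofPred_eq, Set.mem_image, Finset.coe_Ico, Set.mem_Ico]
    constructor
    · rintro ⟨hk, ⟨i, rfl⟩, hkc⟩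
      exact ⟨i, by omega, rfl⟩
    · rintro ⟨i, hi, rfl⟩
      exact ⟨by omega, ⟨i, rfl⟩, by omega⟩
  rw [h, Set.ncard_image_of_injective _ (fun a b hab => by omega),
    Set.ncard_coe_finset, Int.card_Ico]
  omega

/-- If `2 * n = d * m` with `d > 0` and `m`, `(d - 1) * k` have the same parity, then `n` is a
sum of `d` positive terms in arithmetic progression of difference `k` iff `(d - 1) * k < m`. -/
theorem exists_arith_partition_iff {n d m k : ℤ} (hd : 0 < d) (hm : 2 * n = d * m)
    (hpar : Even (m - (d - 1) * k)) :
    (∃ a : ℤ, 0 < a ∧ d * a + d * (d - 1) / 2 * k = n) ↔ (d - 1) * k < m := by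
  obtain ⟨t, ht⟩ : Even (d * (d - 1)) := Int.even_mul_pred_self d
  rw [show d * (d - 1) / 2 = t by omega]
  constructor
  · rintro ⟨a, ha, h⟩
    have : d * (2 * a + (d - 1) * k) = d * m := by linear_combination 2 * h + hm + k * ht
    have := mul_left_cancel₀ hd.ne' this
    omega
  · intro hlt
    obtain ⟨a, ha⟩ := hpar
    refine ⟨a, by omega, ?_⟩
    have : 2 * (d * a + t * k) = 2 * n := by linear_combination -d * ha - k * ht - hm
    omega


/-- Let `n > 0` and let `d` be a positive divisor of `2n` that is not an even
    divisor of `n`, with `1 < d` and `d² < 2n`. The number of odd integers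
    `k > 0` for which `n` admits a partition into `d` positive parts in
    nondecreasing arithmetic progression with common difference `k` (i.e.
    there is a positive integer `a` with `d·a + (d·(d-1)/2)·k = n`) equals
    `⌊⌈2n/(d(d-1))⌉/2⌋`. -/
theorem stmt_17 (n : ℕ) (hn : 0 < n) (d : ℕ) (hdvd : d ∣ 2 * n)
    (hne : ¬(Even d ∧ d ∣ n)) (hd1 : 1 < d) (hd2 : d ^ 2 < 2 * n) :
    ({k : ℤ | 0 < k ∧ Odd k ∧
        ∃ a : ℤ, 0 < a ∧ (d : ℤ) * a + (d : ℤ) * ((d : ℤ) - 1) / 2 * k = (n : ℤ)}.ncard : ℤ)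
      = ⌊((⌈(2 * n : ℚ) / ((d : ℚ) * ((d : ℚ) - 1))⌉ : ℤ) : ℚ) / 2⌋ := by
 
  obtain ⟨m, hm⟩ := hdvd
  have hmZ : 2 * (n : ℤ) = d * m := by exact_mod_cast hm
  have hmQ : 2 * (n : ℚ) = d * m := by exact_mod_cast hm
  have hdQ : (1 : ℚ) < d := by exact_mod_cast hd1
  have hquot : (2 * n : ℚ) / ((d : ℚ) * ((d : ℚ) - 1)) = m / ((d : ℚ) - 1) := by
    rw [hmQ, mul_div_mul_left _ _ (by positivity)]
  have hpar (k : ℤ) (hk : Odd k) : Even ((m : ℤ) - ((d : ℤ) - 1) * k) := by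
    have hmd : Even (m : ℤ) ↔ Odd (d : ℤ) := by
      rw [Int.even_coe_nat, Int.odd_coe_nat, ← Nat.not_even_iff_odd]
      constructor
      · rintro ⟨r, rfl⟩ hde
        exact hne ⟨hde, r, by linarith⟩
      · intro hdo
        have h2 : Even (d * m) := hm ▸ even_two_mul n
        exact (Nat.even_mul.mp h2).resolve_left hdo
    have hk' := Int.not_even_iff_odd.mpr hk
    simp only [Int.even_sub, Int.even_mul, hmd, ← Int.not_even_iff_odd, hk', Int.not_even_one]
    tauto
  have hset : {k : ℤ | 0 < k ∧ Odd k ∧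
        ∃ a : ℤ, 0 < a ∧ (d : ℤ) * a + (d : ℤ) * ((d : ℤ) - 1) / 2 * k = (n : ℤ)} =
      {k : ℤ | 0 < k ∧ Odd k ∧ k < ⌈(m : ℚ) / ((d : ℚ) - 1)⌉} := by
    ext k
    refine and_congr_right fun _ => and_congr_right fun hk => ?_
    rw [exists_arith_partition_iff (by omega) hmZ (hpar k hk), Int.lt_ceil,
      lt_div_iff₀ (by linarith), mul_comm]
    exact_mod_cast Iff.rfl
  rw [hset, hquot, ncard_odd_pos_lt _ (Int.ceil_nonneg (div_nonneg (by positivity) (by linarith)))]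
  exact (Rat.floor_intCast_div_natCast _ 2).symm
end
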